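/- Let E, F be finite-dimensional real inner product spaces, g : E → F^m continuously differentiable with components g_i, r(y) = Σ_{i=1}^m ‖g_i(y)‖, and let r_ε(y) = Σ_{i=1}^m H_ε(g_i(y)) be its ε-smoothing. Suppose y_j → ȳ in E, ε_j > 0 with ε_j → 0, and the gradients ∇r_{ε_j}(y_j) converge to some p ∈ E. Then p belongs to the Clarke subdifferential of r at ȳ, i.e. ⟨p, v⟩ ≤ r°(ȳ; v) for every v ∈ E. -/

import Mathlib

open scoped RealInnerProductSpace

/-- The smoothed norm `H_ε(y) = ‖y‖²/(2ε)` if `‖y‖ ≤ ε`, and `‖y‖ - ε/2` otherwise. -/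
noncomputable def smoothedNorm {F : Type*} [NormedAddCommGroup F] (ε : ℝ) (y : F) : ℝ :=
  if ‖y‖ ≤ ε then ‖y‖ ^ 2 / (2 * ε) else ‖y‖ - ε / 2

/-- The Clarke generalized directional derivative
`f°(x; v) = limsup_{c → x, t ↓ 0} (f(c + t v) − f(c))/t`. -/
noncomputable def clarkeDeriv {E : Type*} [NormedAddCommGroup E] [NormedSpace ℝ E]
    (f : E → ℝ) (x v : E) : ℝ :=
  Filter.limsup (fun p : E × ℝ => (f (p.1 + p.2 • v) - f p.1) / p.2)
    ((nhds x) ×ˢ (nhdsWithin 0 (Set.Ioi 0)))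

section SmoothedNorm

variable {F : Type*} [NormedAddCommGroup F] [InnerProductSpace ℝ F]

theorem inner_sub_le_smoothedNorm {ε : ℝ} (hε : 0 < ε) {q : F} (hq : ‖q‖ ≤ 1) (w : F) :
    ⟪q, w⟫ - ε * ‖q‖ ^ 2 / 2 ≤ smoothedNorm ε w := by
  have hqw := real_inner_le_norm q w
  have hq0 := norm_nonneg q
  unfold smoothedNorm
  split_ifs with h
  · rw [le_div_iff₀ (by positivity)]
    nlinarith [sq_nonneg (‖w‖ - ε * ‖q‖)]
  · push Not at h
    nlinarith [mul_nonneg (sub_nonneg.2 hq) (sub_nonneg.2 h.le),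
      mul_nonneg hε.le (sq_nonneg (1 - ‖q‖))]

theorem smoothedNorm_le_norm_add {ε : ℝ} (hε : 0 < ε) (w u : F) :
    smoothedNorm ε w ≤ ‖u‖ + ‖w - u‖ ^ 2 / (2 * ε) := by
  rw [← sub_le_iff_le_add', le_div_iff₀ (by positivity)]
  unfold smoothedNorm
  split_ifs with h
  · rw [sub_mul, div_mul_cancel₀ _ (by positivity), norm_sub_sq_real]
    nlinarith [real_inner_le_norm w u, sq_nonneg ‖u‖,
      mul_nonneg (norm_nonneg u) (sub_nonneg.2 h)]
  · have hwu : ‖w‖ - ‖u‖ ≤ ‖w - u‖ := norm_sub_norm_le w u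
    nlinarith [sq_nonneg (‖w - u‖ - ε), mul_nonneg hε.le (sub_nonneg.2 hwu)]

/-- The gradient of the smoothed norm. -/
noncomputable def smoothedNormGrad (ε : ℝ) (z : F) : F := (max ε ‖z‖)⁻¹ • z

theorem norm_smoothedNormGrad {ε : ℝ} (hε : 0 < ε) (z : F) :
    ‖smoothedNormGrad ε z‖ = ‖z‖ / max ε ‖z‖ := by
  have hM : 0 < max ε ‖z‖ := lt_max_of_lt_left hε
  rw [smoothedNormGrad, norm_smul, norm_inv, Real.norm_of_nonneg hM.le, inv_mul_eq_div]

theorem norm_smoothedNormGrad_le_one {ε : ℝ} (hε : 0 < ε) (z : F) :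
    ‖smoothedNormGrad ε z‖ ≤ 1 := by
  rw [norm_smoothedNormGrad hε]
  exact div_le_one_of_le₀ (le_max_right _ _) (hε.le.trans (le_max_left _ _))

theorem inner_smoothedNormGrad_self (ε : ℝ) (z : F) :
    ⟪smoothedNormGrad ε z, z⟫ = ‖z‖ ^ 2 / max ε ‖z‖ := by
  rw [smoothedNormGrad, real_inner_smul_left, real_inner_self_eq_norm_sq, inv_mul_eq_div]

theorem norm_sub_le_inner_smoothedNormGrad {ε : ℝ} (hε : 0 < ε) (z : F) :
    ‖z‖ - ε ≤ ⟪smoothedNormGrad ε z, z⟫ := by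
  rw [inner_smoothedNormGrad_self, le_div_iff₀ (lt_max_of_lt_left hε)]
  rcases le_total ε ‖z‖ with h | h
  · rw [max_eq_right h]
    nlinarith [mul_nonneg hε.le (norm_nonneg z)]
  · rw [max_eq_left h]
    nlinarith [mul_nonneg hε.le (sub_nonneg.2 h), sq_nonneg ‖z‖]

theorem smoothedNorm_eq_inner_sub {ε : ℝ} (hε : 0 < ε) (z : F) :
    smoothedNorm ε z = ⟪smoothedNormGrad ε z, z⟫ - ε * ‖smoothedNormGrad ε z‖ ^ 2 / 2 := by
  rw [inner_smoothedNormGrad_self, norm_smoothedNormGrad hε, smoothedNorm]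
  split_ifs with h
  · rw [max_eq_left h]
    field_simp
    ring
  · push Not at h
    have hz : 0 < ‖z‖ := hε.trans h
    rw [max_eq_right h.le]
    field_simp

theorem smoothedNorm_eq_norm_add {ε : ℝ} (hε : 0 < ε) (z : F) :
    smoothedNorm ε z =
      ‖z - ε • smoothedNormGrad ε z‖ + ε * ‖smoothedNormGrad ε z‖ ^ 2 / 2 := by
  have hu : z - ε • smoothedNormGrad ε z = (1 - ε / max ε ‖z‖) • z := by
    rw [smoothedNormGrad, sub_smul, one_smul, smul_smul, div_eq_mul_inv]
  have hM : 0 ≤ 1 - ε / max ε ‖z‖ :=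
    sub_nonneg.2 (div_le_one_of_le₀ (le_max_left _ _) (hε.le.trans (le_max_left _ _)))
  rw [hu, norm_smul, Real.norm_of_nonneg hM, norm_smoothedNormGrad hε, smoothedNorm]
  split_ifs with h
  · rw [max_eq_left h]
    field_simp
    ring
  · push Not at h
    have hz : 0 < ‖z‖ := hε.trans h
    rw [max_eq_right h.le]
    field_simp
    ring

theorem hasFDerivAt_smoothedNorm {ε : ℝ} (hε : 0 < ε) (z : F) :
    HasFDerivAt (smoothedNorm ε) (innerSL ℝ (smoothedNormGrad ε z)) z := by
  rw [hasFDerivAt_iff_isLittleO_nhds_zero]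
  have hO : (fun h : F => smoothedNorm ε (z + h) - smoothedNorm ε z -
      innerSL ℝ (smoothedNormGrad ε z) h) =O[nhds 0] fun h : F => ‖h‖ ^ 2 := by
    refine Asymptotics.IsBigO.of_bound (1 / (2 * ε)) (Filter.Eventually.of_forall fun h => ?_)
    have h₁ := inner_sub_le_smoothedNorm hε (norm_smoothedNormGrad_le_one hε z) (z + h)
    have h₂ := smoothedNorm_le_norm_add hε (z + h) (z - ε • smoothedNormGrad ε z)
    rw [inner_add_right] at h₁
    rw [show z + h - (z - ε • smoothedNormGrad ε z) = ε • smoothedNormGrad ε z + h by abel,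
      norm_add_sq_real, norm_smul, real_inner_smul_left, Real.norm_of_nonneg hε.le] at h₂
    have h₃ : ((ε * ‖smoothedNormGrad ε z‖) ^ 2 + 2 * (ε * ⟪smoothedNormGrad ε z, h⟫)
        + ‖h‖ ^ 2) / (2 * ε) = ε * ‖smoothedNormGrad ε z‖ ^ 2 / 2 + ⟪smoothedNormGrad ε z, h⟫
        + 1 / (2 * ε) * ‖h‖ ^ 2 := by
      field_simp
    have h₄ := smoothedNorm_eq_inner_sub hε z
    have h₅ := smoothedNorm_eq_norm_add hε z
    rw [innerSL_apply_apply, Real.norm_of_nonneg (by linarith),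
      Real.norm_of_nonneg (by positivity)]
    linarith
  refine hO.trans_isLittleO ?_
  simpa using Asymptotics.isLittleO_norm_pow_id (E' := F) one_lt_two

end SmoothedNorm

theorem inner_gradient_sum_smoothedNorm {ι E F : Type*} [Fintype ι]
    [NormedAddCommGroup E] [InnerProductSpace ℝ E] [CompleteSpace E]
    [NormedAddCommGroup F] [InnerProductSpace ℝ F]
    {g : ι → E → F} {x : E} (hg : ∀ i, DifferentiableAt ℝ (g i) x)
    {ε : ℝ} (hε : 0 < ε) (v : E) :
    ⟪gradient (fun w => ∑ i, smoothedNorm ε (g i w)) x, v⟫ =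
      ∑ i, ⟪smoothedNormGrad ε (g i x), fderiv ℝ (g i) x v⟫ := by
  have h : HasFDerivAt (fun w => ∑ i, smoothedNorm ε (g i w))
      (∑ i, (innerSL ℝ (smoothedNormGrad ε (g i x))).comp (fderiv ℝ (g i) x)) x :=
    HasFDerivAt.fun_sum fun i _ =>
      (hasFDerivAt_smoothedNorm hε (g i x)).comp x (hg i).hasFDerivAt
  rw [gradient, InnerProductSpace.toDual_symm_apply, h.fderiv]
  simp

/-- The difference quotients of a locally Lipschitz function are bounded above near a point. -/
theorem isBoundedUnder_le_differenceQuotient {E : Type*} [NormedAddCommGroup E]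
    [NormedSpace ℝ E] {f : E → ℝ} {x : E} {K : NNReal} {s : Set E} (hs : s ∈ nhds x)
    (hf : LipschitzOnWith K f s) (v : E) :
    Filter.IsBoundedUnder (· ≤ ·) (nhds x ×ˢ nhdsWithin 0 (Set.Ioi 0))
      (fun p : E × ℝ => (f (p.1 + p.2 • v) - f p.1) / p.2) := by
  have hle : nhds x ×ˢ nhdsWithin (0 : ℝ) (Set.Ioi 0) ≤ nhds (x, 0) := by
    rw [nhds_prod_eq]
    exact Filter.prod_mono le_rfl nhdsWithin_le_nhds
  have hc : Filter.Tendsto (fun p : E × ℝ => p.1 + p.2 • v) (nhds (x, 0)) (nhds x) := by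
    have : Continuous fun p : E × ℝ => p.1 + p.2 • v := by fun_prop
    simpa using this.tendsto (x, (0 : ℝ))
  refine Filter.isBoundedUnder_of_eventually_le (a := K * ‖v‖) ?_
  filter_upwards [Filter.tendsto_fst.eventually hs, hle (hc hs),
    Filter.tendsto_snd.eventually self_mem_nhdsWithin] with p h₁ h₂ h₃
  have h₃ : 0 < p.2 := h₃
  rw [div_le_iff₀ h₃]
  have h := (le_abs_self _).trans (hf.dist_le_mul _ h₂ _ h₁)
  rw [dist_eq_norm, add_sub_cancel_left, norm_smul, Real.norm_of_nonneg h₃.le] at h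
  linarith

theorem exists_lipschitzOnWith_sum_norm {ι E F : Type*} [Fintype ι]
    [NormedAddCommGroup E] [NormedSpace ℝ E] [NormedAddCommGroup F] [NormedSpace ℝ F]
    {g : ι → E → F} {x : E} (hg : ∀ i, ContDiffAt ℝ 1 (g i) x) :
    ∃ K, ∃ s ∈ nhds x, LipschitzOnWith K (fun w => ∑ i, ‖g i w‖) s := by
  choose K s hs hK using fun i => (hg i).exists_lipschitzOnWith
  refine ⟨∑ i, K i, ⋂ i, s i, Filter.iInter_mem.2 hs, LipschitzOnWith.of_dist_le_mul ?_⟩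
  intro a ha b hb
  rw [Set.mem_iInter] at ha hb
  rw [NNReal.coe_sum, Finset.sum_mul]
  refine (dist_sum_sum_le _ _ _).trans (Finset.sum_le_sum fun i _ => ?_)
  refine (dist_norm_norm_le (g i a) (g i b)).trans ?_
  rw [← dist_eq_norm]
  exact (hK i).dist_le_mul _ (ha i) _ (hb i)

/-- If `y_j → ȳ`, `ε_j ↓ 0` and `∇r_{ε_j}(y_j) → p`, then `p` lies in the Clarke
subdifferential of the (2,1)-norm regularizer `r` at `ȳ`. -/
theorem limit_of_smoothed_gradients_mem_clarkeSubdiff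
    {E F : Type*} [NormedAddCommGroup E] [InnerProductSpace ℝ E] [FiniteDimensional ℝ E]
    [NormedAddCommGroup F] [InnerProductSpace ℝ F] [FiniteDimensional ℝ F]
    {m : ℕ} (g : Fin m → E → F) (hg : ∀ i, ContDiff ℝ 1 (g i))
    (y : ℕ → E) (ybar : E) (hy : Filter.Tendsto y Filter.atTop (nhds ybar))
    (εs : ℕ → ℝ) (hεpos : ∀ j, 0 < εs j)
    (hε0 : Filter.Tendsto εs Filter.atTop (nhds 0))
    (p : E)
    (hp : Filter.Tendsto
      (fun j => gradient (fun w : E => ∑ i, smoothedNorm (εs j) (g i w)) (y j))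
      Filter.atTop (nhds p)) :
    ∀ v : E, ⟪p, v⟫ ≤ clarkeDeriv (fun w : E => ∑ i, ‖g i w‖) ybar v := by
  intro v
  have key : ∀ t : ℝ, 0 < t → t * ⟪p, v⟫ ≤
      ∑ i, (‖g i ybar + t • fderiv ℝ (g i) ybar v‖ - ‖g i ybar‖) := by
    intro t ht
    have hgy : ∀ i, Filter.Tendsto (fun j => g i (y j)) Filter.atTop (nhds (g i ybar)) :=
      fun i => ((hg i).continuous.tendsto ybar).comp hy
    have hdy : ∀ i, Filter.Tendsto (fun j => fderiv ℝ (g i) (y j) v) Filter.atTop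
        (nhds (fderiv ℝ (g i) ybar v)) := fun i =>
      ((((hg i).continuous_fderiv one_ne_zero).clm_apply continuous_const).tendsto ybar).comp hy
    have hr : Filter.Tendsto (fun j => ∑ i, (‖g i (y j) + t • fderiv ℝ (g i) (y j) v‖
        - ‖g i (y j)‖ + εs j)) Filter.atTop
        (nhds (∑ i, (‖g i ybar + t • fderiv ℝ (g i) ybar v‖ - ‖g i ybar‖ + 0))) :=
      tendsto_finsetSum _ fun i _ =>
        ((((hgy i).add ((hdy i).const_smul t)).norm).sub (hgy i).norm).add hε0
    simp only [add_zero] at hr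
    refine le_of_tendsto_of_tendsto' ((hp.inner tendsto_const_nhds).const_mul t) hr fun j => ?_
    rw [inner_gradient_sum_smoothedNorm
      (fun i => (hg i).differentiable one_ne_zero (y j)) (hεpos j), Finset.mul_sum]
    refine Finset.sum_le_sum fun i _ => ?_
    have h₁ := norm_sub_le_inner_smoothedNormGrad (hεpos j) (g i (y j))
    have h₂ := (real_inner_le_norm (smoothedNormGrad (εs j) (g i (y j)))
      (g i (y j) + t • fderiv ℝ (g i) (y j) v)).trans
      (mul_le_of_le_one_left (norm_nonneg _) (norm_smoothedNormGrad_le_one (hεpos j) _))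
    rw [inner_add_right, real_inner_smul_right] at h₂
    linarith
  have hrem : Filter.Tendsto (fun t : ℝ => ∑ i,
      ‖t⁻¹ • (g i (ybar + t • v) - g i ybar) - fderiv ℝ (g i) ybar v‖)
      (nhdsWithin 0 (Set.Ioi 0)) (nhds 0) := by
    have : Filter.Tendsto (fun t : ℝ => ∑ i,
        ‖t⁻¹ • (g i (ybar + t • v) - g i ybar) - fderiv ℝ (g i) ybar v‖)
        (nhdsWithin 0 (Set.Ioi 0)) (nhds (∑ i : Fin m,
          ‖fderiv ℝ (g i) ybar v - fderiv ℝ (g i) ybar v‖)) :=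
      tendsto_finsetSum _ fun i _ =>
        (((((hg i).differentiable one_ne_zero ybar).hasFDerivAt.hasLineDerivAt
          v).tendsto_slope_zero_right).sub tendsto_const_nhds).norm
    simpa using this
  obtain ⟨K, s, hs, hK⟩ := exists_lipschitzOnWith_sum_norm fun i => (hg i).contDiffAt (x := ybar)
  refine le_of_forall_pos_le_add fun δ hδ => ?_
  rw [← sub_le_iff_le_add]
  refine Filter.le_limsup_of_frequently_le ?_ (isBoundedUnder_le_differenceQuotient hs hK v)
  have hev : ∀ᶠ t : ℝ in nhdsWithin 0 (Set.Ioi 0), ⟪p, v⟫ - δ ≤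
      (∑ i, ‖g i (ybar + t • v)‖ - ∑ i, ‖g i ybar‖) / t := by
    filter_upwards [hrem.eventually_lt_const hδ, self_mem_nhdsWithin] with t h₁ ht
    have ht : 0 < t := ht
    rw [le_div_iff₀ ht, ← Finset.sum_sub_distrib]
    have h₂ : ∑ i, (‖g i ybar + t • fderiv ℝ (g i) ybar v‖ - ‖g i ybar‖) ≤
        ∑ i, (‖g i (ybar + t • v)‖ - ‖g i ybar‖) + t * ∑ i,
          ‖t⁻¹ • (g i (ybar + t • v) - g i ybar) - fderiv ℝ (g i) ybar v‖ := by
      rw [Finset.mul_sum, ← Finset.sum_add_distrib]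
      refine Finset.sum_le_sum fun i _ => ?_
      have h₃ := norm_sub_le (g i (ybar + t • v))
        (t • (t⁻¹ • (g i (ybar + t • v) - g i ybar) - fderiv ℝ (g i) ybar v))
      rw [norm_smul, Real.norm_of_nonneg ht.le] at h₃
      have h₄ : g i (ybar + t • v) -
          t • (t⁻¹ • (g i (ybar + t • v) - g i ybar) - fderiv ℝ (g i) ybar v) =
          g i ybar + t • fderiv ℝ (g i) ybar v := by
        rw [smul_sub, smul_inv_smul₀ ht.ne']
        abel
      rw [h₄] at h₃
      linarith
    nlinarith [key t ht]
  have hpath : Filter.Tendsto (fun t : ℝ => (ybar, t)) (nhdsWithin 0 (Set.Ioi 0))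
      (nhds ybar ×ˢ nhdsWithin 0 (Set.Ioi 0)) :=
    Filter.Tendsto.prodMk tendsto_const_nhds Filter.tendsto_id
  exact hpath.frequently hev.frequently
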